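/- In G₁₁ set g = t·s·t⁻¹ and h = t⁻¹·s·t, and let G₁₂ be the subgroup generated by s, g and h. Set y = s·g·h·s. Then y = g·h·s·g = h·s·g·h, y³ = (s·g·h)⁴ = z¹², the center of G₁₂ equals the cyclic subgroup generated by y³ = z¹² (which has order 2), and Z(G₁₂) = G₁₂ ∩ Z(G₁₁); moreover, with Z₁₂ = {1, z¹²}, S = {1, s}, Y = {1, g, g·h, g·h·g}, and X₁₂ = Y ∪ Y·y ∪ Y·y², the map Z₁₂ × S × X₁₂ → G₁₂ sending (c, v, x) to c·v·x is a bijection onto G₁₂. -/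

import Mathlib

open Pointwise

namespace Octa

def rels : Set (FreeGroup (Fin 3)) :=
  { FreeGroup.of 0 ^ 2, FreeGroup.of 1 ^ 3, FreeGroup.of 2 ^ 4,
    FreeGroup.of 0 * FreeGroup.of 1 * FreeGroup.of 2 *
      (FreeGroup.of 1 * FreeGroup.of 2 * FreeGroup.of 0)⁻¹,
    FreeGroup.of 0 * FreeGroup.of 1 * FreeGroup.of 2 *
      (FreeGroup.of 2 * FreeGroup.of 0 * FreeGroup.of 1)⁻¹ }

/-- The group `G₁₁ = ⟨s, t, u | s² = t³ = u⁴ = 1, stu = tus = ust⟩`. -/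
abbrev G11 := PresentedGroup rels

def s : G11 := PresentedGroup.of 0
def t : G11 := PresentedGroup.of 1
def u : G11 := PresentedGroup.of 2
def z : G11 := s * t * u

def g : G11 := t * s * t⁻¹
def h : G11 := t⁻¹ * s * t
def G12 : Subgroup G11 := Subgroup.closure {s, g, h}
def y : G11 := s * g * h * s
def Y : Set G11 := {1, g, g * h, g * h * g}
def X12 : Set G11 := Y ∪ (fun a => a * y) '' Y ∪ (fun a => a * y ^ 2) '' Y


/-- 2 by 2 matrices over the field with 17 elements. -/
abbrev Mat := Matrix (Fin 2) (Fin 2) (ZMod 17)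

def mS : Mat := !![0, 2; 9, 0]
def mT : Mat := !![0, 16; 1, 16]
def mT' : Mat := !![16, 1; 16, 0]
def mU : Mat := !![1, 13; 0, 13]
def mU' : Mat := !![1, 16; 0, 4]

def uS : Matˣ := ⟨mS, mS, by decide +kernel, by decide +kernel⟩
def uT : Matˣ := ⟨mT, mT', by decide +kernel, by decide +kernel⟩
def uU : Matˣ := ⟨mU, mU', by decide +kernel, by decide +kernel⟩

def gens : Fin 3 → Matˣ := ![uS, uT, uU]

theorem gens_rels : ∀ r ∈ rels, FreeGroup.lift gens r = 1 := by
  intro r hr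
  simp only [rels, Set.mem_insert_iff, Set.mem_singleton_iff] at hr
  have e0 : FreeGroup.lift gens (FreeGroup.of 0) = uS := by simp [gens]
  have e1 : FreeGroup.lift gens (FreeGroup.of 1) = uT := by simp [gens]
  have e2 : FreeGroup.lift gens (FreeGroup.of 2) = uU := by simp [gens]
  rcases hr with rfl | rfl | rfl | rfl | rfl
  · rw [map_pow, e0]; ext1; decide +kernel
  · rw [map_pow, e1]; ext1; decide +kernel
  · rw [map_pow, e2]; ext1; decide +kernel
  · rw [map_mul, map_inv, mul_inv_eq_one]
    simp only [map_mul, e0, e1, e2]; ext1; decide +kernel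
  · rw [map_mul, map_inv, mul_inv_eq_one]
    simp only [map_mul, e0, e1, e2]; ext1; decide +kernel

/-- The matrix model of `G11`. -/
def phi : G11 →* Matˣ := PresentedGroup.toGroup gens_rels

def psi : G11 →* Mat := (Units.coeHom Mat).comp phi

theorem phi_s : phi s = uS := PresentedGroup.toGroup.of gens_rels
theorem phi_t : phi t = uT := PresentedGroup.toGroup.of gens_rels
theorem psi_s : psi s = mS := by
  change ((phi s : Matˣ) : Mat) = _
  rw [phi_s]; rfl
theorem psi_g : psi g = mT * mS * mT' := by
  change ((phi (t * s * t⁻¹) : Matˣ) : Mat) = _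
  rw [map_mul, map_mul, map_inv, phi_s, phi_t]; rfl
theorem psi_h : psi h = mT' * mS * mT := by
  change ((phi (t⁻¹ * s * t) : Matˣ) : Mat) = _
  rw [map_mul, map_mul, map_inv, phi_s, phi_t]; rfl

def mG : Mat := mT * mS * mT'
def mH : Mat := mT' * mS * mT
def mY : Mat := mS * mG * mH * mS

theorem psi_y : psi y = mY := by
  simp only [y, map_mul, psi_s, psi_g, psi_h]; rfl

/-- the four elements of `Y` -/
def Yel {M : Type} [Monoid M] (a b : M) : Fin 4 → M := ![1, a, a * b, a * b * a]

/-- the normal form in an arbitrary monoid -/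
def nf {M : Type} [Monoid M] (a b c d : M) (q : Fin 2 × Fin 2 × Fin 4 × Fin 3) : M :=
  (d ^ 3) ^ q.1.val * a ^ q.2.1.val * (Yel b c q.2.2.1 * d ^ q.2.2.2.val)

theorem psi_nf (q) : psi (nf s g h y q) = nf mS mG mH mY q := by
  obtain ⟨i, v, j, k⟩ := q
  have : psi (Yel g h j) = Yel mG mH j := by
    fin_cases j <;> simp [Yel, psi_g, psi_h, mG, mH]
  simp only [nf, map_mul, map_pow, psi_s, psi_y, this]

theorem mat_inj : ∀ q r, nf mS mG mH mY q = nf mS mG mH mY r → q = r := by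
  decide +kernel

theorem mat_center : ∀ q, nf mS mG mH mY q * mS = mS * nf mS mG mH mY q →
    nf mS mG mH mY q * mG = mG * nf mS mG mH mY q → q.2 = (0, 0, 0) := by
  decide +kernel

theorem nf_inj {q r} (e : nf s g h y q = nf s g h y r) : q = r :=
  mat_inj q r (by rw [← psi_nf, ← psi_nf, e])

/-! Relations in `G11`. -/

theorem s_sq : s * s = 1 := by
  have := PresentedGroup.one_of_mem (rels := rels) (x := FreeGroup.of 0 ^ 2) (by simp [rels])
  rw [map_pow, pow_two] at this
  exact this
theorem t_cube : t * t * t = 1 := by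
  have := PresentedGroup.one_of_mem (rels := rels) (x := FreeGroup.of 1 ^ 3) (by simp [rels])
  rw [map_pow, pow_succ, pow_two] at this
  exact this
theorem u_four : u ^ 4 = 1 := by
  have := PresentedGroup.one_of_mem (rels := rels) (x := FreeGroup.of 2 ^ 4) (by simp [rels])
  rw [map_pow] at this
  exact this
theorem stu1 : s * t * u = t * u * s := by
  have := PresentedGroup.one_of_mem (rels := rels) (x := FreeGroup.of 0 * FreeGroup.of 1 * FreeGroup.of 2 *
      (FreeGroup.of 1 * FreeGroup.of 2 * FreeGroup.of 0)⁻¹) (by simp [rels])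
  rw [map_mul, map_inv, mul_inv_eq_one] at this
  simp only [map_mul] at this
  exact this
theorem stu2 : s * t * u = u * s * t := by
  have := PresentedGroup.one_of_mem (rels := rels) (x := FreeGroup.of 0 * FreeGroup.of 1 * FreeGroup.of 2 *
      (FreeGroup.of 2 * FreeGroup.of 0 * FreeGroup.of 1)⁻¹) (by simp [rels])
  rw [map_mul, map_inv, mul_inv_eq_one] at this
  simp only [map_mul] at this
  exact this

theorem zs : s * z = z * s := by
  rw [z, stu1]; simp only [← mul_assoc]; rw [stu1]
theorem zu : u * z = z * u := by
  rw [z]; simp only [← mul_assoc]; rw [← stu2]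
theorem zt : t * z = z * t := by
  conv_lhs => rw [z, stu2]
  rw [z, stu1]; simp only [mul_assoc]

theorem z_comm (a : G11) : Commute z a := by
  have ha : a ∈ Subgroup.closure (Set.range (PresentedGroup.of (rels := rels))) := by
    rw [PresentedGroup.closure_range_of]; trivial
  induction ha using Subgroup.closure_induction with
  | mem x hx =>
    obtain ⟨i, rfl⟩ := hx
    fin_cases i
    · exact zs.symm
    · exact zt.symm
    · exact zu.symm
  | one => exact Commute.one_right _
  | mul x y _ _ h1 h2 => exact h1.mul_right h2
  | inv x _ h1 => exact h1.inv_right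

theorem st4 : (s * t) ^ 4 = z ^ 4 := by
  have : z * u⁻¹ = s * t := by simp [z]
  rw [← this, ((z_comm u).inv_right).mul_pow, inv_pow, u_four]; simp

theorem tinv : t⁻¹ = t * t := by
  rw [inv_eq_iff_mul_eq_one, ← mul_assoc, t_cube]

theorem y_eq : y = z ^ 4 * t⁻¹ := by
  have e : s * t ^ 3 = s := by rw [pow_succ, pow_two, t_cube, mul_one]
  rw [← st4, y, g, h, eq_mul_inv_iff_mul_eq, tinv]
  have t3 : t * (t * t) = 1 := by rw [← mul_assoc, t_cube]
  have t4 (x) : t * (t * (t * x)) = x := by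
    rw [← mul_assoc t t x, ← mul_assoc, ← mul_assoc, t_cube, one_mul]
  simp only [pow_succ, pow_zero, one_mul, mul_assoc, t4]

theorem t3' : t * (t * t) = 1 := by rw [← mul_assoc, t_cube]
theorem t4' (x : G11) : t * (t * (t * x)) = x := by
    rw [← mul_assoc t t x, ← mul_assoc, ← mul_assoc, t_cube, one_mul]

theorem y_eq2 : y = g * h * s * g := by
  have k : (t * s) ^ 4 = z ^ 4 := by
    have : t * s = t * (s * t) * t⁻¹ := by group
    rw [this, conj_pow, st4, mul_inv_eq_iff_eq_mul]
    exact ((z_comm t).pow_left 4).symm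
  rw [y_eq, ← k, g, h, tinv]
  simp only [pow_succ, pow_zero, one_mul, mul_assoc, t4']

theorem y_eq3 : y = h * s * g * h := by
  rw [y_eq, ((z_comm t⁻¹).pow_left 4).eq, ← st4, g, h, tinv]
  simp only [pow_succ, pow_zero, one_mul, mul_assoc, t4']

theorem y3 : y ^ 3 = z ^ 12 := by
  rw [y_eq, ((z_comm t⁻¹).pow_left 4).mul_pow, ← pow_mul]
  have : t⁻¹ ^ 3 = 1 := by rw [inv_pow, pow_succ, pow_two, t_cube, inv_one]
  rw [this, mul_one]

theorem g_sq : g * g = 1 := by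
  rw [g, show t * s * t⁻¹ * (t * s * t⁻¹) = t * (s * s) * t⁻¹ by group, s_sq]; group
theorem h_sq : h * h = 1 := by
  rw [h, show t⁻¹ * s * t * (t⁻¹ * s * t) = t⁻¹ * (s * s) * t by group, s_sq]; group

theorem c_comm (a : G11) : y ^ 3 * a = a * y ^ 3 := by
  rw [y3]; exact (z_comm a).pow_left 12

theorem sy : s * y = y * g := by
  conv_lhs => rw [y_eq2]
  simp only [y, mul_assoc]
theorem gy : g * y = y * h := by
  conv_lhs => rw [y_eq3]
  rw [y_eq2]; simp only [mul_assoc]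
theorem hy : h * y = y * s := by
  rw [y_eq3]; conv_lhs => rw [← y_eq3, y]
  simp only [mul_assoc]

theorem y3w : y ^ 3 = (s * g * h) ^ 4 := by
  have : (s * g * h) ^ 4 = (s * g * h * s) * (g * h * s * g) * (h * s * g * h) := by
    simp only [pow_succ, pow_zero, one_mul, mul_assoc]
  rw [this, ← y_eq2, ← y_eq3, ← y]; simp only [pow_succ, pow_zero, one_mul]

/-- abstract computation: a central element `c = w^4 = (ws)^3`, `s^2 = 1`, squares to `1`. -/
theorem c_sq_aux {G : Type*} [Group G] (c w s : G) (hc : ∀ a, c * a = a * c) (hs : s * s = 1)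
    (hw : w ^ 4 = c) (hy : (w * s) ^ 3 = c) : c * c = 1 := by
  have hs' : s⁻¹ = s := inv_eq_of_mul_eq_one_left hs
  have e1 : s * w * s = c * (w⁻¹ * s * w⁻¹) := by
    have : w * (s * w * s) * (w * s) = c := by
      rw [← hy]; simp only [pow_succ, pow_zero, one_mul, mul_assoc]
    have h2 : s * w * s = w⁻¹ * c * (w * s)⁻¹ := by rw [← this]; group
    rw [h2, mul_inv_rev, hs', ← hc]; simp only [mul_assoc]
  have hq : ∃ q, q = s * w ^ 2 * s := ⟨_, rfl⟩
  obtain ⟨q, hq⟩ := hq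
  have e2 : q = (s * w * s) * (s * w * s) := by
    rw [hq, show (s * w * s) * (s * w * s) = s * w * (s * s) * w * s by simp only [mul_assoc], hs]
    simp only [pow_two, mul_assoc, one_mul]
  have e3 : w⁻¹ * w⁻¹ = c⁻¹ * w ^ 2 := by rw [← hw]; group
  have e4 : q = c * (w⁻¹ * q * w⁻¹) := by
    refine (e2.trans (by rw [e1])).trans ?_
    rw [hc (w⁻¹ * s * w⁻¹)]
    rw [show w⁻¹ * s * w⁻¹ * c * (w⁻¹ * s * w⁻¹ * c) = w⁻¹ * s * w⁻¹ * (c * (w⁻¹ * s * w⁻¹)) * c by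
      simp only [mul_assoc]]
    rw [show w⁻¹ * s * w⁻¹ * (c * (w⁻¹ * s * w⁻¹)) * c = w⁻¹ * s * (w⁻¹ * c * w⁻¹) * (s * w⁻¹) * c by
      simp only [mul_assoc]]
    rw [← hc w⁻¹, mul_assoc c, e3, mul_inv_cancel_left, ← hc, hq]
    simp only [mul_assoc]
  have e5 : q * w * q⁻¹ = c * w⁻¹ := by
    rw [mul_inv_eq_iff_eq_mul]
    nth_rewrite 1 [e4]
    group
  have e6 : (q * w * q⁻¹) ^ 4 = c := by
    rw [conj_pow, hw, ← hc]; group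
  rw [e5, (show Commute c w⁻¹ from hc _).mul_pow, inv_pow, hw] at e6
  have : c ^ 4 * c⁻¹ = c * c * c := by simp [pow_succ, mul_assoc]
  rw [this] at e6
  exact mul_eq_right.mp e6

theorem ws : s * g * h * s = y := rfl

theorem c_sq : y ^ 3 * y ^ 3 = 1 :=
  c_sq_aux (y ^ 3) (s * g * h) s c_comm s_sq y3w.symm (by rw [ws])

/-- `(gs)^3 = c` -/
theorem gs3 : (g * s) ^ 3 = y ^ 3 := by
  have e : g * s = (s * g * h) * y⁻¹ * (s * g * h)⁻¹ := by
    rw [eq_mul_inv_iff_mul_eq, eq_mul_inv_iff_mul_eq]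
    rw [show g * s * (s * g * h) = g * (s * s) * (g * h) by simp only [mul_assoc], s_sq, mul_one,
      ← mul_assoc, g_sq, one_mul, hy]
    rw [y, mul_assoc, s_sq, mul_one]
  rw [e, conj_pow, inv_pow, inv_eq_of_mul_eq_one_left c_sq, ← c_comm]
  group

theorem gh_eq : g * h = s * y * s := by
  simp only [y, mul_assoc, s_sq, mul_one]
  rw [← mul_assoc, s_sq, one_mul]

/-- (1) -/
theorem r1 : h = y ^ 3 * s * (g * h * y ^ 2) := by
  rw [← mul_left_cancel_iff (a := y ^ 3)]
  simp only [← mul_assoc]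
  rw [c_sq, one_mul, show s * g * h = y * s by simp only [y, mul_assoc, s_sq, mul_one]]
  rw [pow_two, ← mul_assoc, mul_assoc y s y, sy, mul_assoc, mul_assoc, gy]
  simp only [pow_succ, pow_zero, one_mul, mul_assoc]

theorem ygs : y * (g * s) = g * h := by
  rw [← mul_assoc, ← sy, gh_eq]

theorem sgh : s * g * h = y * s := by simp only [y, mul_assoc, s_sq, mul_one]

/-- (2) -/
theorem r2 : g * s = y ^ 3 * s * (g * h * g * y) := by
  rw [← mul_left_cancel_iff (a := y), ygs]
  rw [show y * (y ^ 3 * s * (g * h * g * y)) = y * y ^ 3 * ((s * g * h) * (g * y)) by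
    simp only [mul_assoc], sgh, gy]
  rw [show y * y ^ 3 * (y * s * (y * h)) = y ^ 3 * y * y * (s * y) * h by
    rw [c_comm]; simp only [mul_assoc], sy]
  rw [show y ^ 3 * y * y * (y * g) * h = y ^ 3 * y ^ 3 * (g * h) by
    simp only [pow_succ, pow_zero, one_mul, mul_assoc], c_sq, one_mul]

/-- (3) -/
theorem r3 : g * h * g * s = y ^ 3 * s * (g * h * g) := by
  have e : g * s * g * s = y ^ 3 * s * g := by
    have := gs3
    rw [← this, pow_succ, pow_two]
    rw [show g * s * (g * s) * (g * s) * s * g = g * s * (g * s) * (g * (s * s) * g) by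
      simp only [mul_assoc], s_sq, mul_one, g_sq, mul_one]
    simp only [mul_assoc]
  rw [← ygs, show y * (g * s) * g * s = y * (g * s * g * s) by simp only [mul_assoc], e]
  rw [show y ^ 3 * s * (y * (g * s) * g) = y ^ 3 * (s * (y * (g * s)) * g) by
    simp only [mul_assoc], ygs, ← mul_assoc s g h, sgh]
  rw [mul_assoc, ← mul_assoc, ← c_comm]; simp only [mul_assoc]

/-- (4) -/
theorem r4 : g * h * g * h = s * (g * y ^ 2) := by
  rw [show g * h * g * h = (g * h) * (g * h) by simp only [mul_assoc], gh_eq]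
  rw [show s * y * s * (s * y * s) = s * y * (s * s) * y * s by simp only [mul_assoc], s_sq,
    mul_one, pow_two]
  rw [← mul_assoc g, gy, mul_assoc y h y, hy]; simp only [mul_assoc]

/-- (5) -/
theorem r5 : g * h * s = s * y := by rw [y]; simp only [← mul_assoc, s_sq, one_mul]

/-- elements with a normal form (unbounded exponents) -/
def NF (a : G11) : Prop := ∃ (i v k : ℕ) (j : Fin 4), a = (y ^ 3) ^ i * s ^ v * Yel g h j * y ^ k

theorem Yel_mul (j : Fin 4) (a : G11) (ha : a = s ∨ a = g ∨ a = h) : NF (Yel g h j * a) := by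
  rcases ha with rfl | rfl | rfl <;> fin_cases j
  · exact ⟨0, 1, 0, 0, by simp [Yel]⟩
  · exact ⟨1, 1, 1, 3, by simp [Yel, r2, mul_assoc]⟩
  · exact ⟨0, 1, 1, 0, by simp [Yel, r5]⟩
  · exact ⟨1, 1, 0, 3, by simp [Yel, r3]⟩
  · exact ⟨0, 0, 0, 1, by simp [Yel]⟩
  · exact ⟨0, 0, 0, 0, by simp [Yel, g_sq]⟩
  · exact ⟨0, 0, 0, 3, by simp [Yel]⟩
  · exact ⟨0, 0, 0, 2, by simp [Yel, g_sq, mul_assoc]⟩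
  · refine ⟨1, 1, 2, 2, ?_⟩
    have := r1
    simpa [Yel, mul_assoc] using this
  · exact ⟨0, 0, 0, 2, by simp [Yel]⟩
  · exact ⟨0, 0, 0, 1, by simp [Yel, h_sq, mul_assoc]⟩
  · exact ⟨0, 1, 2, 1, by simp [Yel, r4, ← mul_assoc]⟩

theorem ypow_mul (k : ℕ) (a : G11) (ha : a = s ∨ a = g ∨ a = h) :
    ∃ b, (b = s ∨ b = g ∨ b = h) ∧ y ^ k * a = b * y ^ k := by
  induction k generalizing a with
  | zero => exact ⟨a, ha, by simp⟩
  | succ k ih =>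
    have : ∃ b, (b = s ∨ b = g ∨ b = h) ∧ y * a = b * y := by
      rcases ha with rfl | rfl | rfl
      · exact ⟨h, by simp, hy.symm⟩
      · exact ⟨s, by simp, sy.symm⟩
      · exact ⟨g, by simp, gy.symm⟩
    obtain ⟨b, hb, e⟩ := this
    obtain ⟨d, hd, e'⟩ := ih b hb
    exact ⟨d, hd, by rw [pow_succ, mul_assoc, e, ← mul_assoc, e', mul_assoc]⟩

theorem NF_mul (x a : G11) (hx : NF x) (ha : a = s ∨ a = g ∨ a = h) : NF (x * a) := by
  obtain ⟨i, v, k, j, rfl⟩ := hx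
  obtain ⟨b, hb, e⟩ := ypow_mul k a ha
  obtain ⟨i', v', k', j', e'⟩ := Yel_mul j b hb
  refine ⟨i + i', v + v', k' + k, j', ?_⟩
  rw [mul_assoc, e, mul_assoc, ← mul_assoc (Yel g h j), e', pow_add, pow_add, pow_add]
  have hc : s ^ v * (y ^ 3) ^ i' = (y ^ 3) ^ i' * s ^ v :=
    ((show Commute (y ^ 3) (s ^ v) from c_comm _).pow_left i').symm.eq
  simp only [mul_assoc]
  rw [← mul_assoc (s ^ v) ((y ^ 3) ^ i'), hc]
  simp only [mul_assoc]

theorem s_inv : s⁻¹ = s := inv_eq_of_mul_eq_one_left s_sq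
theorem g_inv : g⁻¹ = g := inv_eq_of_mul_eq_one_left g_sq
theorem h_inv : h⁻¹ = h := inv_eq_of_mul_eq_one_left h_sq

theorem NF_of_mem (a : G11) (ha : a ∈ G12) : NF a := by
  unfold G12 at ha
  induction ha using Subgroup.closure_induction_right with
  | one => exact ⟨0, 0, 0, 0, by simp [Yel]⟩
  | mul_right x _ b hb ih => exact NF_mul x b ih (by simpa using hb)
  | mul_inv_cancel x _ b hb ih =>
    have hb' : b = s ∨ b = g ∨ b = h := by simpa using hb
    have : b⁻¹ = b := by
      rcases hb' with rfl | rfl | rfl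
      exacts [s_inv, g_inv, h_inv]
    rw [this]
    exact NF_mul x b ih hb'

theorem nf_of_NF (a : G11) (ha : NF a) : ∃ q, a = nf s g h y q := by
  obtain ⟨i, v, k, j, rfl⟩ := ha
  refine ⟨(⟨(i + k / 3) % 2, Nat.mod_lt _ (by norm_num)⟩, ⟨v % 2, Nat.mod_lt _ (by norm_num)⟩, j,
    ⟨k % 3, Nat.mod_lt _ (by norm_num)⟩), ?_⟩
  have hv : s ^ (v % 2) = s ^ v := (pow_eq_pow_mod v (by rw [pow_two, s_sq])).symm
  have hi : (y ^ 3) ^ ((i + k / 3) % 2) = (y ^ 3) ^ (i + k / 3) :=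
    (pow_eq_pow_mod _ (by rw [pow_two, c_sq])).symm
  have hk : y ^ k = (y ^ 3) ^ (k / 3) * y ^ (k % 3) := by
    rw [← pow_mul, ← pow_add, Nat.div_add_mod]
  have hc (b : G11) : b * (y ^ 3) ^ (k / 3) = (y ^ 3) ^ (k / 3) * b :=
    ((show Commute (y ^ 3) b from c_comm _).pow_left _).symm.eq
  simp only [nf, hv, hi]
  rw [hk, pow_add, ← mul_assoc _ ((y ^ 3) ^ (k / 3)), hc, hc ((y ^ 3) ^ i)]
  simp only [mul_assoc]

theorem s_mem : s ∈ G12 := Subgroup.subset_closure (by simp)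
theorem g_mem : g ∈ G12 := Subgroup.subset_closure (by simp)
theorem h_mem : h ∈ G12 := Subgroup.subset_closure (by simp)
theorem y_mem : y ∈ G12 := mul_mem (mul_mem (mul_mem s_mem g_mem) h_mem) s_mem

theorem nf_mem (q) : nf s g h y q ∈ G12 := by
  obtain ⟨i, v, j, k⟩ := q
  have : Yel g h j ∈ G12 := by
    fin_cases j
    · exact one_mem _
    · exact g_mem
    · exact mul_mem g_mem h_mem
    · exact mul_mem (mul_mem g_mem h_mem) g_mem
  exact mul_mem (mul_mem (pow_mem (pow_mem y_mem _) _) (pow_mem s_mem _))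
    (mul_mem this (pow_mem y_mem _))

theorem Y_iff (x : G11) : x ∈ Y ↔ ∃ j, x = Yel g h j := by
  simp [Y, Yel, Fin.exists_fin_succ]

theorem X_iff (x : G11) : x ∈ X12 ↔ ∃ (j : Fin 4) (k : Fin 3), x = Yel g h j * y ^ k.val := by
  simp only [X12, Set.mem_union, Set.mem_image, Y_iff]
  constructor
  · rintro ((⟨j, rfl⟩ | ⟨_, ⟨j, rfl⟩, rfl⟩) | ⟨_, ⟨j, rfl⟩, rfl⟩)
    · exact ⟨j, 0, by simp⟩
    · exact ⟨j, 1, by simp⟩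
    · exact ⟨j, 2, by simp⟩
  · rintro ⟨j, k, rfl⟩
    fin_cases k
    · exact Or.inl (Or.inl ⟨j, by simp⟩)
    · exact Or.inl (Or.inr ⟨_, ⟨j, rfl⟩, by simp⟩)
    · exact Or.inr ⟨_, ⟨j, rfl⟩, by simp⟩

theorem two_iff (b x : G11) : x ∈ ({1, b} : Set G11) ↔ ∃ i : Fin 2, x = b ^ i.val := by
  simp [Fin.exists_fin_two]

/-- the triple belonging to an index -/
def trip (q : Fin 2 × Fin 2 × Fin 4 × Fin 3) : G11 × G11 × G11 :=
  ((y ^ 3) ^ q.1.val, s ^ q.2.1.val, Yel g h q.2.2.1 * y ^ q.2.2.2.val)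

theorem dom_iff (p : G11 × G11 × G11) :
    p ∈ (({1, z ^ 12} : Set G11) ×ˢ (({1, s} : Set G11) ×ˢ X12)) ↔ ∃ q, p = trip q := by
  obtain ⟨a, b, x⟩ := p
  rw [← y3]
  simp only [Set.mem_prod, two_iff, X_iff]
  constructor
  · rintro ⟨⟨i, rfl⟩, ⟨v, rfl⟩, ⟨j, k, rfl⟩⟩
    exact ⟨(i, v, j, k), rfl⟩
  · rintro ⟨⟨i, v, j, k⟩, e⟩
    simp only [trip, Prod.mk.injEq] at e
    exact ⟨⟨i, e.1⟩, ⟨v, e.2.1⟩, ⟨j, k, e.2.2⟩⟩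

theorem bij : Set.BijOn (fun p : G11 × G11 × G11 => p.1 * p.2.1 * p.2.2)
      (({1, z ^ 12} : Set G11) ×ˢ (({1, s} : Set G11) ×ˢ X12))
      (G12 : Set G11) := by
  refine ⟨?_, ?_, ?_⟩
  · intro p hp
    obtain ⟨q, rfl⟩ := (dom_iff p).1 hp
    exact nf_mem q
  · intro p hp p' hp' e
    obtain ⟨q, rfl⟩ := (dom_iff p).1 hp
    obtain ⟨q', rfl⟩ := (dom_iff p').1 hp'
    have : q = q' := nf_inj e
    rw [this]
  · intro a ha
    obtain ⟨q, rfl⟩ := nf_of_NF a (NF_of_mem a ha)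
    exact ⟨trip q, (dom_iff _).2 ⟨q, rfl⟩, rfl⟩

theorem c_ne : y ^ 3 ≠ 1 := by
  intro e
  have : nf s g h y (1, 0, 0, 0) = nf s g h y (0, 0, 0, 0) := by simp [nf, Yel, e]
  exact absurd (nf_inj this) (by decide)

theorem center_sub (a : G11) (ha : a ∈ G12) (hs : a * s = s * a) (hg : a * g = g * a) :
    a ∈ Subgroup.zpowers (y ^ 3) := by
  obtain ⟨q, rfl⟩ := nf_of_NF a (NF_of_mem a ha)
  have hs' := congrArg psi hs
  have hg' := congrArg psi hg
  rw [map_mul, map_mul, psi_nf, psi_s] at hs'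
  rw [map_mul, map_mul, psi_nf, psi_g] at hg'
  have e := mat_center q hs' hg'
  obtain ⟨i, r⟩ := q
  obtain rfl : r = (0, 0, 0) := e
  have : nf s g h y (i, 0, 0, 0) = (y ^ 3) ^ i.val := by simp [nf, Yel]
  rw [this]
  exact pow_mem (Subgroup.mem_zpowers _) _

theorem zpow_le : Subgroup.zpowers (y ^ 3) ≤ G12 ⊓ Subgroup.center G11 := by
  rw [Subgroup.zpowers_le]
  exact ⟨pow_mem y_mem 3, Subgroup.mem_center_iff.2 fun a => (c_comm a).symm⟩

theorem inf_le_center :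
    G12 ⊓ Subgroup.center G11 ≤ (Subgroup.center ↥G12).map G12.subtype := by
  rintro a ⟨ha, hc⟩
  refine ⟨⟨a, ha⟩, ?_, rfl⟩
  exact Subgroup.mem_center_iff.2 fun b => Subtype.ext (Subgroup.mem_center_iff.1 hc b)

theorem center_le : (Subgroup.center ↥G12).map G12.subtype ≤ Subgroup.zpowers (y ^ 3) := by
  rintro _ ⟨⟨a, ha⟩, hc, rfl⟩
  have hc' := Subgroup.mem_center_iff.1 hc
  exact center_sub a ha (congrArg Subtype.val (hc' ⟨s, s_mem⟩)).symm
    (congrArg Subtype.val (hc' ⟨g, g_mem⟩)).symm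

theorem statement17 :
    y = g * h * s * g ∧
    y = h * s * g * h ∧
    y ^ 3 = (s * g * h) ^ 4 ∧
    y ^ 3 = z ^ 12 ∧
    orderOf (z ^ 12) = 2 ∧
    (Subgroup.center ↥G12).map G12.subtype = Subgroup.zpowers (y ^ 3) ∧
    (Subgroup.center ↥G12).map G12.subtype = G12 ⊓ Subgroup.center G11 ∧
    Set.BijOn (fun p : G11 × G11 × G11 => p.1 * p.2.1 * p.2.2)
      (({1, z ^ 12} : Set G11) ×ˢ (({1, s} : Set G11) ×ˢ X12))
      (G12 : Set G11) := by
  refine ⟨y_eq2, y_eq3, y3w, y3, ?_, ?_, ?_, bij⟩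
  · rw [← y3]
    exact orderOf_eq_prime (by rw [pow_two, c_sq]) c_ne
  · exact le_antisymm center_le (zpow_le.trans inf_le_center)
  · exact le_antisymm (center_le.trans zpow_le) inf_le_center

end Octa
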